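/- Equation (25): let q, h, a, σ, κ be a Frenet frame of a spacelike ruled surface of type M₊², let θ : ℝ → ℝ be smooth, and set q*(s) = sinh θ(s) q(s) + cosh θ(s) h(s). If for every s there exists λ ∈ ℝ with q*'(s) = λ a(s) (the central normal of the Mannheim offset is parallel to the asymptotic normal a of the original surface), then θ'(s) = -σ(s) for all s. -/

import Mathlib

noncomputable section

/-- The Minkowski bilinear form on ℝ³: ⟨x,y⟩ = -x₁y₁ + x₂y₂ + x₃y₃. -/
def mink (x y : Fin 3 → ℝ) : ℝ := -(x 0 * y 0) + x 1 * y 1 + x 2 * y 2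

/-- The Minkowski norm ‖v‖ = √|⟨v,v⟩|. -/
def mnorm (v : Fin 3 → ℝ) : ℝ := Real.sqrt |mink v v|

/-- The determinant of three vectors in ℝ³. -/
def det3 (u v w : Fin 3 → ℝ) : ℝ :=
  u 0 * (v 1 * w 2 - v 2 * w 1) - u 1 * (v 0 * w 2 - v 2 * w 0)
    + u 2 * (v 0 * w 1 - v 1 * w 0)

/-- A Frenet frame of a spacelike ruled surface of type M₊² in Minkowski 3-space:
orthonormal fields `q` (spacelike ruling), `h` (timelike central normal),
`a` (spacelike asymptotic normal), with `σ = ds₁/ds > 0` and conical curvature `κ`,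
satisfying the Frenet equations q' = σh, h' = σ(q + κa), a' = σκh. -/
structure FrenetFrameM2 where
  q : ℝ → Fin 3 → ℝ
  h : ℝ → Fin 3 → ℝ
  a : ℝ → Fin 3 → ℝ
  σ : ℝ → ℝ
  κ : ℝ → ℝ
  smooth_q : ContDiff ℝ (⊤ : ℕ∞) q
  smooth_h : ContDiff ℝ (⊤ : ℕ∞) h
  smooth_a : ContDiff ℝ (⊤ : ℕ∞) a
  smooth_σ : ContDiff ℝ (⊤ : ℕ∞) σ
  smooth_κ : ContDiff ℝ (⊤ : ℕ∞) κ
  hqq : ∀ s, mink (q s) (q s) = 1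
  hhh : ∀ s, mink (h s) (h s) = -1
  haa : ∀ s, mink (a s) (a s) = 1
  hqh : ∀ s, mink (q s) (h s) = 0
  hqa : ∀ s, mink (q s) (a s) = 0
  hha : ∀ s, mink (h s) (a s) = 0
  σ_pos : ∀ s, 0 < σ s
  frenet_q : ∀ s, deriv q s = σ s • h s
  frenet_h : ∀ s, deriv h s = σ s • (q s + κ s • a s)
  frenet_a : ∀ s, deriv a s = (σ s * κ s) • h s

theorem mink_add_left (x y z : Fin 3 → ℝ) : mink (x + y) z = mink x z + mink y z := by
  simp only [mink, Pi.add_apply]; ring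

theorem mink_smul_left (c : ℝ) (x y : Fin 3 → ℝ) : mink (c • x) y = c * mink x y := by
  simp only [mink, Pi.smul_apply, smul_eq_mul]; ring

theorem mink_comm (x y : Fin 3 → ℝ) : mink x y = mink y x := by
  simp only [mink]; ring

namespace FrenetFrameM2

theorem hasDerivAt_q (F : FrenetFrameM2) (s : ℝ) : HasDerivAt F.q (F.σ s • F.h s) s :=
  F.frenet_q s ▸ (F.smooth_q.differentiable (by simp) s).hasDerivAt

theorem hasDerivAt_h (F : FrenetFrameM2) (s : ℝ) :
    HasDerivAt F.h (F.σ s • (F.q s + F.κ s • F.a s)) s :=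
  F.frenet_h s ▸ (F.smooth_h.differentiable (by simp) s).hasDerivAt

end FrenetFrameM2

/-- Equation (25): if the derivative of the ruling q* = sinh θ q + cosh θ h of the
Mannheim offset is parallel to the asymptotic normal a, then θ' = -σ. -/
theorem mannheim_offset_angle_deriv (F : FrenetFrameM2)
    (θ : ℝ → ℝ) (hθ : ContDiff ℝ (⊤ : ℕ∞) θ)
    (hpar : ∀ s, ∃ lam : ℝ,
      deriv (fun t => Real.sinh (θ t) • F.q t + Real.cosh (θ t) • F.h t) s
        = lam • F.a s) :
    ∀ s, deriv θ s = -F.σ s := by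
  intro s
  obtain ⟨lam, hlam⟩ := hpar s
  have hθs : HasDerivAt θ (deriv θ s) s := (hθ.differentiable (by simp) s).hasDerivAt
  have hq := hθs.sinh.smul (F.hasDerivAt_q s)
  have hh := hθs.cosh.smul (F.hasDerivAt_h s)
  have hder := (hq.add hh).deriv.symm.trans hlam
  have hinner := congrArg (fun v => mink v (F.q s)) hder
  simp only [mink_add_left, mink_smul_left, F.hqq, mink_comm (F.h s) (F.q s), F.hqh,
    mink_comm (F.a s) (F.q s), F.hqa] at hinner
  have hprod : Real.cosh (θ s) * (deriv θ s + F.σ s) = 0 := by linear_combination hinner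
  have hsum := (mul_eq_zero.mp hprod).resolve_left (Real.cosh_pos _).ne'
  linarith
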